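/- arXiv:2305.00734 — 6 statements merged into one kernel-verified Lean document; each statement's English description precedes it below -/
import Mathlib

section
/- For every λ > 0 there exists a bounded continuous function h : [0,∞) → ℝ such that for all x, y ∈ ℝ with x ≠ y, π · ∫₀^∞ e^{−λt} · (1/π) · t/((x−y)² + t²) dt = log₊(1/|x−y|) + h(|x−y|). -/
open Real MeasureTheory Set Filter Topology

noncomputable def kk (lam r t : ℝ) : ℝ :=
  (Real.exp (-lam * t) - (Ioc (0:ℝ) 1).indicator (fun _ => (1:ℝ)) t) * (t / (r ^ 2 + t ^ 2))

lemma kk_bound (lam : ℝ) (hlam : 0 < lam) (r t : ℝ) (ht : 0 < t) :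
    |kk lam r t| ≤ (lam * Real.exp lam + 1) * Real.exp (-lam * t) := by
  have hd : 0 < r ^ 2 + t ^ 2 := by positivity
  have hq : 0 ≤ t / (r ^ 2 + t ^ 2) := by positivity
  have he := Real.exp_pos (-lam * t)
  unfold kk
  rw [abs_mul, abs_of_nonneg hq]
  by_cases h1 : t ≤ 1
  · rw [indicator_of_mem (show t ∈ Ioc (0:ℝ) 1 from ⟨ht, h1⟩)]
    have h2 : Real.exp (-lam * t) ≤ 1 := by
      rw [Real.exp_le_one_iff]; nlinarith
    have h3 := Real.add_one_le_exp (-lam * t)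
    have h4 : |Real.exp (-lam * t) - 1| ≤ lam * t := by
      rw [abs_of_nonpos (by linarith)]; linarith
    have h5 : lam * t * (t / (r ^ 2 + t ^ 2)) ≤ lam := by
      rw [← mul_div_assoc, div_le_iff₀ hd]; nlinarith [sq_nonneg r]
    have h6 : 1 ≤ Real.exp lam * Real.exp (-lam * t) := by
      rw [← Real.exp_add]; apply Real.one_le_exp; nlinarith
    calc _ ≤ lam * t * (t / (r ^ 2 + t ^ 2)) := by gcongr
      _ ≤ lam := h5
      _ ≤ _ := by nlinarith
  · rw [indicator_of_notMem (fun h => h1 h.2), sub_zero, abs_of_pos he]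
    have h5 : t / (r ^ 2 + t ^ 2) ≤ 1 := by
      rw [div_le_one hd]; nlinarith [sq_nonneg r]
    have : 0 < lam * Real.exp lam := by positivity
    nlinarith [mul_pos this he]

lemma kk_meas (lam r : ℝ) : Measurable (kk lam r) := by
  unfold kk
  have : Measurable ((Ioc (0:ℝ) 1).indicator (fun _ => (1:ℝ))) :=
    measurable_const.indicator measurableSet_Ioc
  fun_prop

lemma bd_int (lam : ℝ) (hlam : 0 < lam) :
    IntegrableOn (fun t => (lam * Real.exp lam + 1) * Real.exp (-lam * t)) (Ioi 0) :=
  (exp_neg_integrableOn_Ioi 0 hlam).const_mul _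

lemma kk_ae (lam : ℝ) (hlam : 0 < lam) (r : ℝ) : ∀ᵐ t ∂(volume.restrict (Ioi (0:ℝ))),
    ‖kk lam r t‖ ≤ (lam * Real.exp lam + 1) * Real.exp (-lam * t) :=
  (ae_restrict_iff' measurableSet_Ioi).2 (Eventually.of_forall fun t ht => kk_bound lam hlam r t ht)

lemma kk_int (lam : ℝ) (hlam : 0 < lam) (r : ℝ) : IntegrableOn (kk lam r) (Ioi 0) :=
  (bd_int lam hlam).mono' (kk_meas lam r).aestronglyMeasurable (kk_ae lam hlam r)

lemma kk_cont (lam : ℝ) (hlam : 0 < lam) :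
    Continuous fun r => ∫ t in Ioi (0:ℝ), kk lam r t := by
  apply continuous_of_dominated (fun r => (kk_meas lam r).aestronglyMeasurable)
    (kk_ae lam hlam) (bd_int lam hlam)
  refine (ae_restrict_iff' measurableSet_Ioi).2 (Eventually.of_forall fun t ht => ?_)
  have ht : 0 < t := ht
  unfold kk
  refine continuous_const.mul (continuous_const.div (by fun_prop) fun r => ?_)
  positivity

lemma cont_q (r : ℝ) (hr : 0 < r) : Continuous fun t : ℝ => t / (r ^ 2 + t ^ 2) :=
  continuous_id.div (by fun_prop) fun t => by positivity

lemma log_int (r : ℝ) (hr : 0 < r) :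
    ∫ t in Ioc (0:ℝ) 1, t / (r ^ 2 + t ^ 2) = (1/2) * Real.log (1 + r ^ 2) - Real.log r := by
  rw [← intervalIntegral.integral_of_le zero_le_one]
  have hderiv : ∀ t ∈ uIcc (0:ℝ) 1,
      HasDerivAt (fun t => (1/2) * Real.log (r ^ 2 + t ^ 2)) (t / (r ^ 2 + t ^ 2)) t := by
    intro t _
    have hd : r ^ 2 + t ^ 2 ≠ 0 := by positivity
    have h1 : HasDerivAt (fun t : ℝ => r ^ 2 + t ^ 2) (2 * t) t := by
      simpa using (hasDerivAt_pow 2 t).const_add (r ^ 2)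
    refine ((h1.log hd).const_mul (1/2)).congr_deriv ?_
    ring
  rw [intervalIntegral.integral_eq_sub_of_hasDerivAt hderiv
    ((cont_q r hr).intervalIntegrable _ _)]
  have : Real.log (r ^ 2 + 0 ^ 2) = 2 * Real.log r := by
    rw [zero_pow two_ne_zero, add_zero, Real.log_pow]; norm_num
  rw [this, one_pow, add_comm (r ^ 2) 1]; ring

lemma main_int (lam : ℝ) (hlam : 0 < lam) (r : ℝ) (hr : 0 < r) :
    ∫ t in Ioi (0:ℝ), Real.exp (-lam * t) * (t / (r ^ 2 + t ^ 2)) =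
      (∫ t in Ioi (0:ℝ), kk lam r t) + ((1/2) * Real.log (1 + r ^ 2) - Real.log r) := by
  have hi : IntegrableOn ((Ioc (0:ℝ) 1).indicator fun t => t / (r ^ 2 + t ^ 2)) (Ioi 0) := by
    refine Integrable.integrableOn ?_
    rw [integrable_indicator_iff measurableSet_Ioc]
    exact (cont_q r hr).integrableOn_Ioc
  have h2 : ∫ t in Ioi (0:ℝ), (Ioc (0:ℝ) 1).indicator (fun t => t / (r ^ 2 + t ^ 2)) t
      = (1/2) * Real.log (1 + r ^ 2) - Real.log r := by
    rw [setIntegral_indicator measurableSet_Ioc,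
      inter_eq_self_of_subset_right Ioc_subset_Ioi_self, log_int r hr]
  rw [← h2, ← integral_add (kk_int lam hlam r) hi]
  congr 1
  ext t
  unfold kk
  by_cases h : t ∈ Ioc (0:ℝ) 1
  · rw [indicator_of_mem h, indicator_of_mem h]; ring
  · rw [indicator_of_notMem h, indicator_of_notMem h]; ring

theorem stmt1 (lam : ℝ) (hlam : 0 < lam) :
    ∃ h : ℝ → ℝ, ContinuousOn h (Ici 0) ∧ (∃ M : ℝ, ∀ r ∈ Ici (0:ℝ), |h r| ≤ M) ∧
      ∀ x y : ℝ, x ≠ y →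
        π * ∫ t in Ioi (0:ℝ),
            Real.exp (-lam * t) * ((1 / π) * (t / ((x - y) ^ 2 + t ^ 2)))
          = max (Real.log (1 / |x - y|)) 0 + h |x - y| := by
  refine ⟨fun r => (∫ t in Ioi (0:ℝ), kk lam r t) +
    ((1/2) * Real.log (1 + r ^ 2) - Real.log (max r 1)), ?_, ?_, ?_⟩
  · apply Continuous.continuousOn
    refine (kk_cont lam hlam).add ((continuous_const.mul ?_).sub ?_)
    · exact Continuous.log (by fun_prop) fun r => by positivity
    · exact Continuous.log (by fun_prop) fun r => by positivity
  · refine ⟨(∫ t in Ioi (0:ℝ), (lam * Real.exp lam + 1) * Real.exp (-lam * t)) +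
      (1/2) * Real.log 2, fun r hr => ?_⟩
    have hr : 0 ≤ r := hr
    refine (abs_add_le _ _).trans (add_le_add ?_ ?_)
    · exact norm_integral_le_of_norm_le (bd_int lam hlam) (kk_ae lam hlam r)
    · have hm : 0 < max r 1 := by positivity
      have e : Real.log (max r 1) = (1/2) * Real.log ((max r 1) ^ 2) := by
        rw [Real.log_pow]; push_cast; ring
      have h1 : (max r 1) ^ 2 ≤ 1 + r ^ 2 := by
        rcases max_cases r 1 with h | h <;> rw [h.1] <;> nlinarith
      have h2 : 1 + r ^ 2 ≤ 2 * (max r 1) ^ 2 := by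
        nlinarith [le_max_left r 1, le_max_right r 1]
      have l1 := Real.log_le_log (by positivity) h1
      have l2 := Real.log_le_log (by positivity) h2
      rw [Real.log_mul (by norm_num) (by positivity)] at l2
      rw [e, abs_of_nonneg (by linarith)]
      linarith
  · intro x y hxy
    have hr : 0 < |x - y| := abs_pos.2 (sub_ne_zero.2 hxy)
    rw [← integral_const_mul, ← sq_abs (x - y)]
    generalize |x - y| = r at hr
    have e : ∀ t : ℝ, π * (Real.exp (-lam * t) * ((1 / π) * (t / (r ^ 2 + t ^ 2)))) =
        Real.exp (-lam * t) * (t / (r ^ 2 + t ^ 2)) := by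
      intro t
      have := Real.pi_ne_zero
      field_simp
    simp only [e]
    rw [main_int lam hlam r hr, one_div r, Real.log_inv]
    have : max (-Real.log r) 0 = Real.log (max r 1) - Real.log r := by
      rcases le_total r 1 with h | h
      · rw [max_eq_right h, Real.log_one, max_eq_left]
        · ring
        · linarith [Real.log_nonpos hr.le h]
      · rw [max_eq_left h, max_eq_right]
        · ring
        · linarith [Real.log_nonneg h]
    rw [this]; ring
end

section
/- Let t > 0 and let f_n, f : [0,t] → ℝ be continuous non-decreasing functions. If ∫₀^t |f_n(s) − f(s)| ds → 0 as n → ∞, then f_n(s) → f(s) for every s ∈ (0,t). -/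
open Real MeasureTheory Set Filter Topology

theorem stmt4_aux (t a b c : ℝ) (h : ℝ → ℝ) (hc : ContinuousOn h (Icc 0 t))
    (ha : 0 ≤ a) (hab : a ≤ b) (hb : b ≤ t) (hle : ∀ x ∈ Icc a b, c ≤ |h x|) :
    c * (b - a) ≤ ∫ s in Icc (0:ℝ) t, |h s| := by
  have hsub : Icc a b ⊆ Icc 0 t := Icc_subset_Icc ha hb
  have hi : IntegrableOn (fun s => |h s|) (Icc 0 t) := hc.abs.integrableOn_Icc
  calc c * (b - a) = ∫ s in Icc a b, c := by
        simp [hab, mul_comm]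
    _ ≤ ∫ s in Icc a b, |h s| :=
        setIntegral_mono_on (by simp) (hi.mono_set hsub) measurableSet_Icc hle
    _ ≤ ∫ s in Icc (0:ℝ) t, |h s| :=
        setIntegral_mono_set hi (ae_of_all _ fun x => abs_nonneg _) hsub.eventuallyLE

theorem stmt4 (t : ℝ) (ht : 0 < t) (f : ℕ → ℝ → ℝ) (g : ℝ → ℝ)
    (hfc : ∀ n, ContinuousOn (f n) (Icc 0 t)) (hfm : ∀ n, MonotoneOn (f n) (Icc 0 t))
    (hgc : ContinuousOn g (Icc 0 t)) (hgm : MonotoneOn g (Icc 0 t))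
    (hL1 : Tendsto (fun n => ∫ s in Icc (0:ℝ) t, |f n s - g s|) atTop (𝓝 0)) :
    ∀ s ∈ Ioo (0:ℝ) t, Tendsto (fun n => f n s) atTop (𝓝 (g s)) := by
  intro s hs
  obtain ⟨hs0, hst⟩ := hs
  rw [Metric.tendsto_atTop']
  intro ε hε
  obtain ⟨δ₀, hδ₀, hg⟩ := Metric.continuousOn_iff.1 hgc s ⟨hs0.le, hst.le⟩ (ε / 2) (by positivity)
  obtain ⟨δ, hδ, hδm⟩ := exists_between (lt_min hδ₀ (lt_min hs0 (sub_pos.2 hst)))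
  rw [lt_min_iff, lt_min_iff] at hδm
  obtain ⟨h1, h2, h3⟩ := hδm
  obtain ⟨N, hN⟩ := Metric.tendsto_atTop'.1 hL1 (ε / 2 * δ) (by positivity)
  refine ⟨N, fun n hn => ?_⟩
  have hI := hN n hn
  rw [Real.dist_eq, sub_zero] at hI
  have hI := (le_abs_self _).trans_lt hI
  have hg' : ∀ x, s - δ ≤ x → x ≤ s + δ → |g x - g s| < ε / 2 := fun x hx hx' => by
    have := hg x ⟨by linarith, by linarith⟩ (by rw [Real.dist_eq, abs_lt]; constructor <;> linarith)
    rwa [Real.dist_eq] at this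
  have hcc : ContinuousOn (fun x => f n x - g x) (Icc 0 t) := (hfc n).sub hgc
  rw [Real.dist_eq]
  by_contra! hcon
  rcases le_abs.1 hcon with h | h
  · have := stmt4_aux t s (s + δ) (ε / 2) _ hcc hs0.le (by linarith) (by linarith) (by
      intro x hx
      have a := abs_lt.1 (hg' x (by linarith [hx.1]) hx.2)
      have b := hfm n ⟨hs0.le, hst.le⟩ ⟨by linarith [hx.1], by linarith [hx.2]⟩ hx.1
      exact le_abs.2 (Or.inl (by linarith [a.2])))
    rw [add_sub_cancel_left] at this
    linarith
  · have := stmt4_aux t (s - δ) s (ε / 2) _ hcc (by linarith) (by linarith) (by linarith) (by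
      intro x hx
      have a := abs_lt.1 (hg' x hx.1 (by linarith [hx.2]))
      have b := hfm n ⟨by linarith [hx.1], by linarith [hx.2]⟩ ⟨hs0.le, hst.le⟩ hx.2
      exact le_abs.2 (Or.inr (by linarith [a.1])))
    rw [sub_sub_cancel] at this
    linarith
end

section
/- Fix λ > 0 and γ with 0 < γ² < 2. Define g : (0,∞) → ℝ by g(r) := ∫₀^∞ e^{−λt} · exp(−r²/(2t))/(2πt) dt. Then lim_{T→∞} ∫₀¹ ∫₀¹ ( ∫_{ℝ²} exp(γ²·π·g(√T·‖y‖)) · exp(−‖y‖²/(2|t−s|))/(2π|t−s|) dy ) ds dt = 1, where the inner integral is understood for t ≠ s (a set of full measure in [0,1]²). -/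
open Real MeasureTheory Set Filter Topology

/-- The Green function. -/
noncomputable def grn (lam r : ℝ) : ℝ :=
  ∫ u in Ioi (0:ℝ), Real.exp (-lam * u) * (Real.exp (-r ^ 2 / (2 * u)) / (2 * π * u))

lemma grn_measurable (lam : ℝ) : Measurable (grn lam) := by
  unfold grn
  apply StronglyMeasurable.measurable
  apply StronglyMeasurable.integral_prod_right
  apply Measurable.stronglyMeasurable
  unfold Function.uncurry
  fun_prop

lemma grn_integrand_bound {lam r u : ℝ} (hr : 0 < r) (hu : 0 < u) :
    Real.exp (-lam * u) * (Real.exp (-r ^ 2 / (2 * u)) / (2 * π * u))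
      ≤ (1 / (π * r ^ 2)) * Real.exp (-lam * u) := by
  rw [mul_comm]
  refine mul_le_mul_of_nonneg_right ?_ (Real.exp_pos _).le
  have hx : 0 < r ^ 2 / (2 * u) := by positivity
  have h1 : r ^ 2 / (2 * u) ≤ Real.exp (r ^ 2 / (2 * u)) := by
    linarith [Real.add_one_le_exp (r ^ 2 / (2 * u))]
  rw [neg_div, Real.exp_neg]
  have h2 : (Real.exp (r ^ 2 / (2 * u)))⁻¹ ≤ (r ^ 2 / (2 * u))⁻¹ := by gcongr
  calc (Real.exp (r ^ 2 / (2 * u)))⁻¹ / (2 * π * u) ≤ (r ^ 2 / (2 * u))⁻¹ / (2 * π * u) := by gcongr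
    _ = _ := by field_simp

lemma grn_integrable {lam r : ℝ} (hlam : 0 < lam) (hr : 0 < r) :
    IntegrableOn (fun u => Real.exp (-lam * u) * (Real.exp (-r ^ 2 / (2 * u)) / (2 * π * u)))
      (Ioi 0) := by
  have h := (exp_neg_integrableOn_Ioi 0 hlam).const_mul (1 / (π * r ^ 2))
  refine h.mono' ?_ ?_
  · apply Measurable.aestronglyMeasurable; fun_prop
  · filter_upwards [self_mem_ae_restrict measurableSet_Ioi] with u hu
    have hu : 0 < u := hu
    rw [Real.norm_of_nonneg (by positivity)]
    exact grn_integrand_bound hr hu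

lemma grn_nonneg (lam r : ℝ) : 0 ≤ grn lam r := by
  apply setIntegral_nonneg measurableSet_Ioi
  intro u hu
  have hu : 0 < u := hu
  positivity

lemma grn_le {lam r : ℝ} (hlam : 0 < lam) (hr : 0 < r) : grn lam r ≤ 1 / (π * r ^ 2) / lam := by
  have h := (exp_neg_integrableOn_Ioi 0 hlam).const_mul (1 / (π * r ^ 2))
  calc grn lam r ≤ ∫ u in Ioi (0:ℝ), (1 / (π * r ^ 2)) * Real.exp (-lam * u) :=
        setIntegral_mono_on (grn_integrable hlam hr) h measurableSet_Ioi
          (fun u hu => grn_integrand_bound hr hu)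
    _ = _ := by
        rw [integral_const_mul, integral_exp_mul_Ioi (by linarith)]
        simp
        field_simp

lemma grn_tendsto {lam : ℝ} (hlam : 0 < lam) : Tendsto (grn lam) atTop (𝓝 0) := by
  have h : Tendsto (fun r : ℝ => (1 / (π * lam)) * (r ^ 2)⁻¹) atTop (𝓝 0) := by
    have := (tendsto_inv_atTop_zero.comp (tendsto_pow_atTop (α := ℝ) (n := 2) (by norm_num))).const_mul
      (1 / (π * lam))
    simpa using this
  refine squeeze_zero' (Eventually.of_forall (grn_nonneg lam)) ?_ h
  filter_upwards [eventually_gt_atTop 0] with r hr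
  refine (grn_le hlam hr).trans (le_of_eq ?_)
  field_simp

lemma grn_le_log {lam r : ℝ} (hlam : 0 < lam) (hr : 0 < r) (hr1 : r ≤ 1) :
    grn lam r ≤ (1 / π) * (-Real.log r) + (1 / π + 1 / (π * lam)) := by
  have hr2 : 0 < r ^ 2 := by positivity
  have hr21 : r ^ 2 ≤ 1 := by nlinarith
  have hI := grn_integrable hlam hr
  set f := fun u => Real.exp (-lam * u) * (Real.exp (-r ^ 2 / (2 * u)) / (2 * π * u)) with hf
  have hI1 : IntegrableOn f (Ioc 0 1) := hI.mono_set Ioc_subset_Ioi_self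
  have hI2 : IntegrableOn f (Ioi 1) := hI.mono_set (Ioi_subset_Ioi zero_le_one)
  have hI3 : IntegrableOn f (Ioc 0 (r ^ 2)) := hI.mono_set Ioc_subset_Ioi_self
  have hI4 : IntegrableOn f (Ioc (r ^ 2) 1) :=
    hI.mono_set (Ioc_subset_Ioi_self.trans (Ioi_subset_Ioi hr2.le))
  have e1 : grn lam r = (∫ u in Ioc 0 (r ^ 2), f u) + (∫ u in Ioc (r ^ 2) 1, f u)
      + ∫ u in Ioi 1, f u := by
    rw [← setIntegral_union (Ioc_disjoint_Ioc_of_le le_rfl) measurableSet_Ioc hI3 hI4,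
      Ioc_union_Ioc_eq_Ioc hr2.le hr21,
      ← setIntegral_union (Ioc_disjoint_Ioi le_rfl) measurableSet_Ioi hI1 hI2,
      Ioc_union_Ioi_eq_Ioi zero_le_one]
    rfl
  have b1 : (∫ u in Ioc 0 (r ^ 2), f u) ≤ 1 / π := by
    calc (∫ u in Ioc 0 (r ^ 2), f u) ≤ ∫ u in Ioc 0 (r ^ 2), (1 / (π * r ^ 2)) := by
          refine setIntegral_mono_on hI3 (integrableOn_const (by simp)) measurableSet_Ioc ?_
          intro u hu
          refine (grn_integrand_bound hr hu.1).trans ?_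
          have : Real.exp (-lam * u) ≤ 1 := by
            rw [Real.exp_le_one_iff]; nlinarith [hu.1]
          exact mul_le_of_le_one_right (by positivity) this
      _ = _ := by
          simp [hr2.le]
          field_simp
  have b2 : (∫ u in Ioc (r ^ 2) 1, f u) ≤ (1 / π) * (-Real.log r) := by
    have hint : IntervalIntegrable (fun u : ℝ => (1 / (2 * π)) * (1 / u)) volume (r ^ 2) 1 := by
      apply IntervalIntegrable.const_mul
      apply intervalIntegral.intervalIntegrable_one_div _ continuousOn_id
      intro x hx
      rw [uIcc_of_le hr21] at hx
      exact (hr2.trans_le hx.1).ne'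
    calc (∫ u in Ioc (r ^ 2) 1, f u) ≤ ∫ u in Ioc (r ^ 2) 1, (1 / (2 * π)) * (1 / u) := by
          refine setIntegral_mono_on hI4 hint.1 measurableSet_Ioc ?_
          intro u hu
          have hu0 : 0 < u := hr2.trans hu.1
          have h1 : Real.exp (-lam * u) ≤ 1 := by
            rw [Real.exp_le_one_iff]; nlinarith
          have h2 : Real.exp (-r ^ 2 / (2 * u)) ≤ 1 := by
            rw [Real.exp_le_one_iff, neg_div]; 
            have : 0 < r ^ 2 / (2 * u) := by positivity
            linarith
          calc f u ≤ 1 * (1 / (2 * π * u)) := by simp only [hf]; gcongr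
            _ = _ := by field_simp
      _ = _ := by
          rw [← intervalIntegral.integral_of_le hr21, intervalIntegral.integral_const_mul,
            integral_one_div_of_pos hr2 one_pos, one_div (r ^ 2), Real.log_inv, Real.log_pow]
          field_simp
          norm_num
  have b3 : (∫ u in Ioi 1, f u) ≤ 1 / (π * lam) := by
    have h := (exp_neg_integrableOn_Ioi 1 hlam)
    calc (∫ u in Ioi 1, f u) ≤ ∫ u in Ioi 1, (1 / π) * Real.exp (-lam * u) := by
          refine setIntegral_mono_on hI2 (h.const_mul _) measurableSet_Ioi ?_
          intro u hu
          have hu : 1 < u := hu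
          have h2 : Real.exp (-r ^ 2 / (2 * u)) ≤ 1 := by
            rw [Real.exp_le_one_iff, neg_div]; 
            have : 0 < r ^ 2 / (2 * u) := by positivity
            linarith
          rw [mul_comm (1 / π)]
          simp only [hf]
          gcongr
          nlinarith [Real.pi_pos]
      _ = (1 / π) * (Real.exp (-lam) / lam) := by
          rw [integral_const_mul, integral_exp_mul_Ioi (by linarith)]
          simp
      _ ≤ (1 / π) * (1 / lam) := by
          gcongr
          rw [Real.exp_le_one_iff]; linarith
      _ = _ := by field_simp
  linarith

lemma exp_grn_bound {lam γ : ℝ} (hlam : 0 < lam) (hγ0 : 0 < γ) :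
    ∃ C : ℝ, 0 < C ∧ ∀ r, 0 < r →
      Real.exp (γ ^ 2 * π * grn lam r) ≤ C * (1 + r ^ (-γ ^ 2)) := by
  refine ⟨Real.exp (γ ^ 2 * (1 + 1 / lam)), Real.exp_pos _, fun r hr => ?_⟩
  have hp : 0 < r ^ (-γ ^ 2) := by positivity
  rcases le_total r 1 with h1 | h1
  · calc Real.exp (γ ^ 2 * π * grn lam r)
        ≤ Real.exp (γ ^ 2 * π * ((1 / π) * (-Real.log r) + (1 / π + 1 / (π * lam)))) := by
          gcongr; exact grn_le_log hlam hr h1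
      _ = Real.exp (γ ^ 2 * (1 + 1 / lam)) * r ^ (-γ ^ 2) := by
          rw [Real.rpow_def_of_pos hr, ← Real.exp_add]
          congr 1
          field_simp
          ring
      _ ≤ _ := by gcongr; linarith
  · calc Real.exp (γ ^ 2 * π * grn lam r)
        ≤ Real.exp (γ ^ 2 * (1 + 1 / lam)) := by
          rw [Real.exp_le_exp, mul_assoc]
          gcongr
          calc π * grn lam r ≤ π * (1 / (π * r ^ 2) / lam) := by gcongr; exact grn_le hlam hr
            _ = (1 / r ^ 2) * (1 / lam) := by field_simp
            _ ≤ 1 * (1 / lam) := by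
              gcongr
              rw [div_le_one (by positivity)]; nlinarith
            _ ≤ _ := by linarith
      _ ≤ _ := by
          apply le_mul_of_one_le_right (by positivity); linarith

/-- The heat kernel. -/
noncomputable def hk (τ : ℝ) (y : EuclideanSpace ℝ (Fin 2)) : ℝ :=
  Real.exp (-‖y‖ ^ 2 / (2 * τ)) / (2 * π * τ)

lemma hk_moment {τ q : ℝ} (hτ : 0 < τ) (hq : -2 < q) :
    Integrable (fun y => ‖y‖ ^ q * hk τ y) ∧
    ∫ y, ‖y‖ ^ q * hk τ y = (2 * τ) ^ (q / 2) * Real.Gamma ((q + 2) / 2) := by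
  have hb : 0 < 1 / (2 * τ) := by positivity
  have key := Complex.integral_rpow_mul_exp_neg_mul_rpow (p := 2) (by norm_num) hq hb
  have mp := Complex.orthonormalBasisOneI.measurePreserving_repr
  have e : ∫ y, ‖y‖ ^ q * hk τ y = (2 * τ) ^ (q / 2) * Real.Gamma ((q + 2) / 2) := by
    rw [← mp.integral_comp Complex.orthonormalBasisOneI.repr.toHomeomorph.measurableEmbedding]
    have : ∀ x : ℂ, ‖Complex.orthonormalBasisOneI.repr x‖ ^ q
        * hk τ (Complex.orthonormalBasisOneI.repr x)
        = (1 / (2 * π * τ)) * (‖x‖ ^ q * Real.exp (-(1 / (2 * τ)) * ‖x‖ ^ (2 : ℝ))) := by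
      intro x
      simp only [hk, LinearIsometryEquiv.norm_map, Real.rpow_two]
      rw [show -‖x‖ ^ 2 / (2 * τ) = -(1 / (2 * τ)) * ‖x‖ ^ 2 by ring]
      ring
    simp_rw [this]
    rw [integral_const_mul, key, one_div (2 * τ), Real.inv_rpow (by positivity),
      ← Real.rpow_neg (by positivity), show -(-(q + 2) / 2) = q / 2 + 1 by ring,
      Real.rpow_add_one (by positivity)]
    field_simp
  refine ⟨?_, e⟩
  by_contra h
  rw [integral_undef h] at e
  have h1 : 0 < (2 * τ) ^ (q / 2) := by positivity
  have h2 : 0 < Real.Gamma ((q + 2) / 2) := Real.Gamma_pos_of_pos (by linarith)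
  have := mul_pos h1 h2
  linarith

lemma hk_mass {τ : ℝ} (hτ : 0 < τ) : Integrable (hk τ) ∧ ∫ y, hk τ y = 1 := by
  have := hk_moment (q := 0) hτ (by norm_num)
  simpa using this

lemma hk_nonneg {τ : ℝ} (hτ : 0 ≤ τ) (y) : 0 ≤ hk τ y := by unfold hk; positivity

/-- The integrand. -/
noncomputable def Phi (lam γ T t s : ℝ) (y : EuclideanSpace ℝ (Fin 2)) : ℝ :=
  Real.exp (γ ^ 2 * π * grn lam (Real.sqrt T * ‖y‖)) * hk |t - s| y

lemma Phi_meas (lam γ T : ℝ) :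
    Measurable (fun p : (ℝ × ℝ) × EuclideanSpace ℝ (Fin 2) => Phi lam γ T p.1.1 p.1.2 p.2) := by
  have h := grn_measurable lam
  have h2 : Measurable (fun p : (ℝ × ℝ) × EuclideanSpace ℝ (Fin 2) =>
    grn lam (Real.sqrt T * ‖p.2‖)) := h.comp (by fun_prop)
  unfold Phi hk
  fun_prop

lemma Phi_bound {lam γ C : ℝ} (hC : ∀ r, 0 < r →
      Real.exp (γ ^ 2 * π * grn lam r) ≤ C * (1 + r ^ (-γ ^ 2))) (hC0 : 0 < C)
    {T t s : ℝ} (hT : 1 ≤ T) {y : EuclideanSpace ℝ (Fin 2)} (hy : y ≠ 0) :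
    ‖Phi lam γ T t s y‖ ≤ C * (hk |t - s| y + ‖y‖ ^ (-γ ^ 2) * hk |t - s| y) := by
  have hy0 : 0 < ‖y‖ := norm_pos_iff.2 hy
  have hk0 := hk_nonneg (abs_nonneg (t - s)) y
  have hs : 1 ≤ Real.sqrt T := Real.one_le_sqrt.2 hT
  rw [Phi, Real.norm_of_nonneg (by positivity)]
  have h1 := hC (Real.sqrt T * ‖y‖) (by positivity)
  have h2 : (Real.sqrt T * ‖y‖) ^ (-γ ^ 2) ≤ ‖y‖ ^ (-γ ^ 2) := by
    apply Real.rpow_le_rpow_of_nonpos hy0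
    · exact le_mul_of_one_le_left hy0.le hs
    · nlinarith [sq_nonneg γ]
  calc _ ≤ (C * (1 + ‖y‖ ^ (-γ ^ 2))) * hk |t - s| y := by
        gcongr
        exact h1.trans (by gcongr)
    _ = _ := by ring

lemma ae_ne_zero : ∀ᵐ y : EuclideanSpace ℝ (Fin 2), y ≠ 0 := by
  simp [ae_iff]

lemma bound_integral {γ C : ℝ} (hγ2 : γ ^ 2 < 2) {τ : ℝ} (hτ : 0 < τ) :
    Integrable (fun y => C * (hk τ y + ‖y‖ ^ (-γ ^ 2) * hk τ y)) ∧
    ∫ y, C * (hk τ y + ‖y‖ ^ (-γ ^ 2) * hk τ y) =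
      C * (1 + (2 * τ) ^ (-γ ^ 2 / 2) * Real.Gamma ((-γ ^ 2 + 2) / 2)) := by
  obtain ⟨h1, h2⟩ := hk_mass hτ
  obtain ⟨h3, h4⟩ := hk_moment (q := -γ ^ 2) hτ (by linarith)
  refine ⟨(h1.add h3).const_mul C, ?_⟩
  rw [integral_const_mul, integral_add h1 h3, h2, h4]

lemma inner_tendsto {lam γ : ℝ} (hlam : 0 < lam) (hγ0 : 0 < γ) (hγ2 : γ ^ 2 < 2) {t s : ℝ}
    (hts : s ≠ t) : Tendsto (fun T => ∫ y, Phi lam γ T t s y) atTop (𝓝 1) := by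
  obtain ⟨C, hC0, hC⟩ := exp_grn_bound hlam hγ0
  have hτ : 0 < |t - s| := abs_pos.2 (sub_ne_zero.2 hts.symm)
  rw [← (hk_mass hτ).2]
  apply tendsto_integral_filter_of_dominated_convergence
    (fun y => C * (hk |t - s| y + ‖y‖ ^ (-γ ^ 2) * hk |t - s| y))
  · refine Eventually.of_forall fun T => ?_
    exact ((Phi_meas lam γ T).comp (measurable_prodMk_left (x := (t, s)))).aestronglyMeasurable
  · filter_upwards [eventually_ge_atTop 1] with T hT
    filter_upwards [ae_ne_zero] with y hy
    exact Phi_bound hC hC0 hT hy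
  · exact (bound_integral hγ2 hτ).1
  · filter_upwards [ae_ne_zero] with y hy
    have hy0 : 0 < ‖y‖ := norm_pos_iff.2 hy
    have h1 : Tendsto (fun T : ℝ => Real.sqrt T * ‖y‖) atTop atTop :=
      Real.tendsto_sqrt_atTop.atTop_mul_const hy0
    have h2 := ((grn_tendsto hlam).comp h1).const_mul (γ ^ 2 * π)
    have h3 := ((Real.continuous_exp.tendsto _).comp h2).mul_const (hk |t - s| y)
    simpa [Phi] using h3

lemma inner_bound {lam γ C : ℝ} (hγ2 : γ ^ 2 < 2) (hC : ∀ r, 0 < r →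
      Real.exp (γ ^ 2 * π * grn lam r) ≤ C * (1 + r ^ (-γ ^ 2))) (hC0 : 0 < C)
    {T t s : ℝ} (hT : 1 ≤ T) (hts : s ≠ t) :
    ‖∫ y, Phi lam γ T t s y‖ ≤
      C * (1 + (2 * |t - s|) ^ (-γ ^ 2 / 2) * Real.Gamma ((-γ ^ 2 + 2) / 2)) := by
  have hτ : 0 < |t - s| := abs_pos.2 (sub_ne_zero.2 hts.symm)
  obtain ⟨h1, h2⟩ := bound_integral (C := C) hγ2 hτ
  rw [← h2]
  apply norm_integral_le_of_norm_le h1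
  filter_upwards [ae_ne_zero] with y hy
  exact Phi_bound hC hC0 hT hy

lemma abs_rpow_int {β : ℝ} (hβ : -1 < β) :
    IntegrableOn (fun x : ℝ => (2 * |x|) ^ β) (Icc (-1) 1) := by
  have h0 : IntegrableOn (fun x : ℝ => (2 * |x|) ^ β) (Ioc 0 1) := by
    have h := ((intervalIntegral.intervalIntegrable_rpow' (a := 0) (b := 1) hβ).1).const_mul (2 ^ β)
    refine h.congr ?_
    filter_upwards [self_mem_ae_restrict measurableSet_Ioc] with x hx
    rw [abs_of_pos hx.1, Real.mul_rpow (by norm_num) hx.1.le]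
  have h1 : IntervalIntegrable (fun x : ℝ => (2 * |x|) ^ β) volume 0 1 :=
    (intervalIntegrable_iff_integrableOn_Ioc_of_le zero_le_one).2 h0
  have h2 : IntervalIntegrable (fun x : ℝ => (2 * |x|) ^ β) volume 0 (-1) := by
    have := (IntervalIntegrable.iff_comp_neg (f := fun x : ℝ => (2 * |x|) ^ β) (a := 0) (b := -1)
      (by simp)).2
    apply this
    simpa using h1
  rw [← intervalIntegrable_iff_integrableOn_Icc_of_le (by norm_num)]
  exact h2.symm.trans h1

lemma bound2 {β : ℝ} (hβ : -1 < β) {t : ℝ} (ht : t ∈ Icc (0:ℝ) 1) :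
    IntegrableOn (fun s : ℝ => (2 * |t - s|) ^ β) (Icc 0 1) ∧
    ∫ s in Icc (0:ℝ) 1, (2 * |t - s|) ^ β ≤ ∫ x in Icc (-1:ℝ) 1, (2 * |x|) ^ β := by
  have h := abs_rpow_int hβ
  have hsub : Icc (t - 1) t ⊆ Icc (-1:ℝ) 1 := Icc_subset_Icc (by linarith [ht.1]) ht.2
  have h' := h.mono_set hsub
  constructor
  · rw [← intervalIntegrable_iff_integrableOn_Icc_of_le (by linarith)] at h' ⊢
    have := h'.comp_sub_left t (by simp)
    simpa using this.symm
  · calc ∫ s in Icc (0:ℝ) 1, (2 * |t - s|) ^ β = ∫ x in Icc (t - 1) t, (2 * |x|) ^ β := by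
          rw [integral_Icc_eq_integral_Ioc, integral_Icc_eq_integral_Ioc,
            ← intervalIntegral.integral_of_le zero_le_one,
            ← intervalIntegral.integral_of_le (by linarith),
            intervalIntegral.integral_comp_sub_left (fun x => (2 * |x|) ^ β)]
          simp
      _ ≤ _ := by
          apply setIntegral_mono_set h
          · exact Eventually.of_forall fun x => by positivity
          · exact hsub.eventuallyLE

lemma ae_ne_restrict (t : ℝ) : ∀ᵐ s ∂(volume.restrict (Icc (0:ℝ) 1)), s ≠ t := by
  apply ae_restrict_of_ae
  simp [ae_iff]

lemma main_aux (lam γ : ℝ) (hlam : 0 < lam) (hγ0 : 0 < γ) (hγ2 : γ ^ 2 < 2) :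
    Tendsto (fun T : ℝ => ∫ t in Icc (0:ℝ) 1, ∫ s in Icc (0:ℝ) 1, ∫ y, Phi lam γ T t s y)
      atTop (𝓝 1) := by
  obtain ⟨C, hC0, hC⟩ := exp_grn_bound hlam hγ0
  set G := Real.Gamma ((-γ ^ 2 + 2) / 2) with hG
  have hG0 : 0 < G := Real.Gamma_pos_of_pos (by linarith)
  have hβ : -1 < -γ ^ 2 / 2 := by linarith
  have hm : ∀ T, StronglyMeasurable (fun p : ℝ × ℝ => ∫ y, Phi lam γ T p.1 p.2 y) := fun T =>
    (Phi_meas lam γ T).stronglyMeasurable.integral_prod_right'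
  have one : ∫ s in Icc (0:ℝ) 1, (1:ℝ) = 1 := by simp
  set K := ∫ x in Icc (-1:ℝ) 1, (2 * |x|) ^ (-γ ^ 2 / 2) with hK
  have hbi : ∀ t ∈ Icc (0:ℝ) 1,
      IntegrableOn (fun s => C * (1 + (2 * |t - s|) ^ (-γ ^ 2 / 2) * G)) (Icc 0 1) := by
    intro t ht
    exact ((integrableOn_const (by simp)).add ((bound2 hβ ht).1.mul_const G)).const_mul C
  have hle : ∀ t ∈ Icc (0:ℝ) 1,
      ∫ s in Icc (0:ℝ) 1, C * (1 + (2 * |t - s|) ^ (-γ ^ 2 / 2) * G) ≤ C * (1 + K * G) := by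
    intro t ht
    have hc : Integrable (fun _ : ℝ => (1:ℝ)) (volume.restrict (Icc (0:ℝ) 1)) :=
      integrableOn_const (by simp)
    rw [integral_const_mul, integral_add hc
      ((bound2 hβ ht).1.mul_const G), one, integral_mul_const]
    gcongr
    exact (bound2 hβ ht).2
  have step : ∀ t ∈ Icc (0:ℝ) 1,
      Tendsto (fun T => ∫ s in Icc (0:ℝ) 1, ∫ y, Phi lam γ T t s y) atTop (𝓝 1) := by
    intro t ht
    rw [show 𝓝 (1:ℝ) = 𝓝 (∫ s in Icc (0:ℝ) 1, (1:ℝ)) by rw [one]]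
    apply tendsto_integral_filter_of_dominated_convergence
      (fun s => C * (1 + (2 * |t - s|) ^ (-γ ^ 2 / 2) * G))
    · refine Eventually.of_forall fun T => ?_
      exact ((hm T).comp_measurable (measurable_prodMk_left (x := t))).aestronglyMeasurable
    · filter_upwards [eventually_ge_atTop 1] with T hT
      filter_upwards [ae_ne_restrict t] with s hs
      exact inner_bound hγ2 hC hC0 hT hs
    · exact hbi t ht
    · filter_upwards [ae_ne_restrict t] with s hs
      exact inner_tendsto hlam hγ0 hγ2 hs
  rw [show 𝓝 (1:ℝ) = 𝓝 (∫ s in Icc (0:ℝ) 1, (1:ℝ)) by rw [one]]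
  apply tendsto_integral_filter_of_dominated_convergence (fun _ => C * (1 + K * G))
  · refine Eventually.of_forall fun T => ?_
    exact (hm T).integral_prod_right'.aestronglyMeasurable
  · filter_upwards [eventually_ge_atTop 1] with T hT
    filter_upwards [self_mem_ae_restrict measurableSet_Icc] with t ht
    refine le_trans (norm_integral_le_of_norm_le (hbi t ht) ?_) (hle t ht)
    filter_upwards [ae_ne_restrict t] with s hs
    exact inner_bound hγ2 hC hC0 hT hs
  · exact integrableOn_const (by simp)
  · filter_upwards [self_mem_ae_restrict measurableSet_Icc] with t ht
    exact step t ht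

theorem stmt7 (lam γ : ℝ) (hlam : 0 < lam) (hγ0 : 0 < γ) (hγ2 : γ ^ 2 < 2) :
    Tendsto (fun T : ℝ =>
      ∫ t in Icc (0:ℝ) 1, ∫ s in Icc (0:ℝ) 1,
        ∫ y : EuclideanSpace ℝ (Fin 2),
          Real.exp (γ ^ 2 * π * ∫ u in Ioi (0:ℝ),
              Real.exp (-lam * u) *
                (Real.exp (-(Real.sqrt T * ‖y‖) ^ 2 / (2 * u)) / (2 * π * u))) *
            (Real.exp (-‖y‖ ^ 2 / (2 * |t - s|)) / (2 * π * |t - s|)))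
      atTop (𝓝 1) :=
  main_aux lam γ hlam hγ0 hγ2
end

section
/- Fix λ > 0 and γ with 0 < γ² < 1. Define g : (0,∞) → ℝ by g(r) := ∫₀^∞ e^{−λt} · (1/π) · t/(r² + t²) dt. Then lim_{T→∞} ∫₀¹ ∫₀¹ ( ∫_ℝ exp(γ²·π·g(T·|y|)) · (1/π) · |t−s|/(y² + |t−s|²) dy ) ds dt = 1, where the inner integral is understood for t ≠ s (a set of full measure in [0,1]²). -/
open Real MeasureTheory Set Filter Topology

noncomputable def g8 (lam r : ℝ) : ℝ :=
  ∫ u in Ioi (0:ℝ), Real.exp (-lam * u) * ((1 / π) * (u / (r ^ 2 + u ^ 2)))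

lemma g8_meas (lam : ℝ) : Measurable (g8 lam) := by
  have : StronglyMeasurable (fun p : ℝ × ℝ =>
      Real.exp (-lam * p.2) * ((1 / π) * (p.2 / (p.1 ^ 2 + p.2 ^ 2)))) := by
    apply Measurable.stronglyMeasurable
    fun_prop
  exact (this.integral_prod_right (ν := volume.restrict (Ioi (0:ℝ)))).measurable

lemma exp_int (lam : ℝ) (h : 0 < lam) : IntegrableOn (fun u => Real.exp (-lam * u)) (Ioi 0) :=
  integrableOn_exp_mul_Ioi (by linarith) 0

lemma exp_val (lam : ℝ) (h : 0 < lam) : ∫ u in Ioi (0:ℝ), Real.exp (-lam * u) = 1 / lam := by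
  rw [integral_exp_mul_Ioi (by linarith) 0]
  simp

lemma g8_nonneg (lam r : ℝ) : 0 ≤ g8 lam r := by
  apply setIntegral_nonneg measurableSet_Ioi
  intro u hu
  have : 0 < u := hu
  positivity

lemma g8_le1 (lam r : ℝ) (h : 0 < lam) (hr : 0 < r) :
    g8 lam r ≤ 1 / lam * (1 / r) := by
  have : ∫ u in Ioi (0:ℝ), Real.exp (-lam * u) * (1 / r) = 1 / lam * (1/r) := by
    rw [integral_mul_const, exp_val lam h]
  rw [← this]
  apply integral_mono_of_nonneg
  · filter_upwards [ae_restrict_mem measurableSet_Ioi] with u hu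
    have : 0 < u := hu
    simp only [Pi.zero_apply]
    positivity
  · exact (exp_int lam h).mul_const _
  · filter_upwards [ae_restrict_mem measurableSet_Ioi] with u hu
    have hu : 0 < u := hu
    have h1 : 1 / π ≤ 1 := by
      rw [div_le_one Real.pi_pos]; linarith [Real.pi_gt_three]
    have h2 : u / (r^2+u^2) ≤ 1 / r := by
      rw [div_le_div_iff₀ (by positivity) hr]
      nlinarith [sq_nonneg (r-u), mul_pos hu hr]
    have : 1 / π * (u / (r^2+u^2)) ≤ 1 * (1/r) := by gcongr
    rw [one_mul] at this
    gcongr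

lemma g8_le2 (lam r : ℝ) (h : 0 < lam) (hr : 0 < r) :
    π * g8 lam r ≤ 1 / 2 * Real.log (1 + (r ^ 2)⁻¹) + 1 / lam := by
  have hcont : Continuous (fun u : ℝ => u / (r^2+u^2)) := by
    apply Continuous.div (by fun_prop) (by fun_prop)
    intro u; positivity
  have hI : IntegrableOn (fun u : ℝ => u / (r^2+u^2)) (Ioc 0 1) :=
    hcont.integrableOn_Ioc
  have e1 : ∫ u in Ioc (0:ℝ) 1, u / (r^2+u^2) = 1 / 2 * Real.log (1 + (r ^ 2)⁻¹) := by
    rw [← intervalIntegral.integral_of_le zero_le_one]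
    rw [intervalIntegral.integral_eq_sub_of_hasDerivAt (f := fun u => 1/2 * Real.log (r^2+u^2))]
    · have : 1 + (r^2)⁻¹ = (r^2+1^2) / (r^2+0^2) := by field_simp; ring
      rw [this, Real.log_div (by positivity) (by positivity)]; ring
    · intro u _
      have h0 : r^2+u^2 ≠ 0 := by positivity
      have := (((hasDerivAt_pow 2 u).const_add (r^2)).log h0).const_mul (1/2)
      refine this.congr_deriv ?_
      push_cast
      field_simp
      try ring
    · exact hcont.intervalIntegrable _ _
  have hI2 : Integrable ((Ioc (0:ℝ) 1).indicator (fun u : ℝ => u / (r^2+u^2))) (volume.restrict (Ioi 0)) :=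
    ((integrable_indicator_iff measurableSet_Ioc).2 hI).integrableOn
  have : ∫ u in Ioi (0:ℝ), ((Ioc (0:ℝ) 1).indicator (fun u : ℝ => u / (r^2+u^2)) u
      + Real.exp (-lam * u)) = 1 / 2 * Real.log (1 + (r ^ 2)⁻¹) + 1 / lam := by
    rw [integral_add hI2 (exp_int lam h), exp_val lam h, setIntegral_indicator measurableSet_Ioc,
      inter_eq_right.2 Ioc_subset_Ioi_self, e1]
  rw [← this, g8, ← integral_const_mul]
  apply integral_mono_of_nonneg
  · filter_upwards [ae_restrict_mem measurableSet_Ioi] with u hu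
    have : 0 < u := hu
    simp only [Pi.zero_apply]
    positivity
  · exact hI2.add (exp_int lam h)
  · filter_upwards [ae_restrict_mem measurableSet_Ioi] with u hu
    have hu : 0 < u := hu
    have e : π * (Real.exp (-lam * u) * (1 / π * (u / (r ^ 2 + u ^ 2)))) =
      Real.exp (-lam * u) * (u / (r^2+u^2)) := by field_simp
    simp only [e]
    by_cases h1 : u ≤ 1
    · rw [indicator_of_mem (show u ∈ Ioc (0:ℝ) 1 from ⟨hu, h1⟩)]
      have : Real.exp (-lam * u) ≤ 1 := by
        rw [Real.exp_le_one_iff]; nlinarith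
      have h3 : 0 ≤ u / (r^2+u^2) := by positivity
      nlinarith [Real.exp_pos (-lam * u)]
    · rw [indicator_of_notMem (fun hh => h1 hh.2)]
      have : u / (r^2+u^2) ≤ 1 := by
        rw [div_le_one (by positivity)]; nlinarith
      nlinarith [Real.exp_pos (-lam * u)]

lemma exp_bound (lam a r : ℝ) (h : 0 < lam) (ha : 0 < a) (ha1 : a < 1) (hr : 0 < r) :
    Real.exp (a * π * g8 lam r) ≤ Real.exp (a / lam) * (1 + r ^ (-a)) := by
  have h1 : a * π * g8 lam r ≤ Real.log (1 + (r ^ 2)⁻¹) * (a / 2) + a / lam := by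
    have := mul_le_mul_of_nonneg_left (g8_le2 lam r h hr) ha.le
    calc _ = a * (π * g8 lam r) := by ring
      _ ≤ _ := this
      _ = _ := by ring
  refine (Real.exp_le_exp.2 h1).trans ?_
  rw [Real.exp_add, mul_comm, ← Real.rpow_def_of_pos (by positivity)]
  gcongr
  refine (Real.rpow_add_le_add_rpow zero_le_one (by positivity) (by positivity) (by linarith)).trans ?_
  rw [Real.one_rpow, ← Real.rpow_natCast, ← Real.rpow_neg hr.le, ← Real.rpow_mul hr.le]
  apply le_of_eq; congr 2; push_cast; ring

lemma abs_int (a : ℝ) (ha1 : a < 1) : IntegrableOn (fun z : ℝ => |z| ^ (-a)) (Icc (-1) 1) := by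
  have h1 : IntervalIntegrable (fun z : ℝ => |z| ^ (-a)) volume 0 1 := by
    refine (intervalIntegral.intervalIntegrable_rpow' (r := -a) (by linarith)).congr ?_
    intro z hz
    rw [uIoc_of_le zero_le_one] at hz
    simp only [abs_of_pos hz.1]
  have h2 : IntervalIntegrable (fun z : ℝ => |z| ^ (-a)) volume (-1) 0 := by
    have := (IntervalIntegrable.iff_comp_neg).1 h1
    simp only [abs_neg, neg_zero] at this
    exact this.symm
  rw [integrableOn_Icc_iff_integrableOn_Ioc, ← intervalIntegrable_iff_integrableOn_Ioc_of_le (by norm_num)]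
  exact h2.trans h1

lemma cauchy_int (a : ℝ) (ha : 0 < a) (ha1 : a < 1) :
    Integrable (fun z : ℝ => |z| ^ (-a) * (1 + z^2)⁻¹) := by
  have hI := ((integrable_indicator_iff measurableSet_Icc).2 (abs_int a ha1)).add
    integrable_inv_one_add_sq
  refine hI.mono' (by apply Measurable.aestronglyMeasurable; fun_prop) (ae_of_all _ fun z => ?_)
  rw [Real.norm_of_nonneg (by positivity)]
  simp only [Pi.add_apply]
  have h3 : 0 < (1 + z^2)⁻¹ := by positivity
  by_cases hz : z ∈ Icc (-1:ℝ) 1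
  · rw [indicator_of_mem hz]
    have : (1 + z^2)⁻¹ ≤ 1 := inv_le_one_of_one_le₀ (by nlinarith [sq_nonneg z])
    have : 0 ≤ |z| ^ (-a) := by positivity
    nlinarith
  · rw [indicator_of_notMem hz, zero_add]
    have : |z| ^ (-a) ≤ 1 := by
      apply Real.rpow_le_one_of_one_le_of_nonpos _ (by linarith)
      by_contra hc
      push Not at hc
      exact hz (abs_le.1 hc.le)
    nlinarith

noncomputable def H8 (lam a R : ℝ) : ℝ :=
  ∫ z : ℝ, Real.exp (a * π * g8 lam (R * |z|)) * ((1 / π) * (1 + z^2)⁻¹)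

noncomputable def P8 (lam a T τ : ℝ) : ℝ :=
  ∫ y : ℝ, Real.exp (a * π * g8 lam (T * |y|)) * ((1 / π) * (τ / (y^2 + τ^2)))

lemma P8_eq (lam a T τ : ℝ) (hτ : 0 < τ) : P8 lam a T τ = H8 lam a (T * τ) := by
  have := Measure.integral_comp_mul_left (fun y : ℝ =>
    Real.exp (a * π * g8 lam (T * |y|)) * ((1 / π) * (τ / (y^2 + τ^2)))) τ
  rw [abs_of_pos (by positivity), smul_eq_mul, inv_mul_eq_div, eq_div_iff hτ.ne'] at this
  rw [P8, ← this, H8, mul_comm, ← integral_const_mul]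
  congr 1; ext z
  rw [abs_mul, abs_of_pos hτ, ← mul_assoc T]
  have : τ / ((τ * z)^2 + τ^2) = τ⁻¹ * (1+z^2)⁻¹ := by
    have : (1 + z^2) ≠ 0 := by positivity
    have : (τ * z)^2 + τ^2 ≠ 0 := by positivity
    field_simp; ring
  rw [this]; field_simp

lemma P8_meas (lam a T : ℝ) : Measurable (P8 lam a T) := by
  have hg := g8_meas lam
  have : StronglyMeasurable (fun p : ℝ × ℝ =>
      Real.exp (a * π * g8 lam (T * |p.2|)) * ((1 / π) * (p.1 / (p.2^2 + p.1^2)))) := by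
    apply Measurable.stronglyMeasurable
    fun_prop
  exact (this.integral_prod_right (ν := volume)).measurable

lemma integrand_bound (lam a R z : ℝ) (h : 0 < lam) (ha : 0 < a) (ha1 : a < 1) (hR : 0 < R)
    (hz : z ≠ 0) :
    Real.exp (a * π * g8 lam (R * |z|)) * ((1 / π) * (1 + z^2)⁻¹) ≤
      Real.exp (a / lam) * ((1 + z^2)⁻¹ + R ^ (-a) * (|z| ^ (-a) * (1 + z^2)⁻¹)) := by
  have hz' := abs_pos.2 hz
  have h1 := exp_bound lam a (R * |z|) h ha ha1 (by positivity)
  have hp : 1 / π ≤ 1 := by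
    rw [div_le_one Real.pi_pos]; linarith [Real.pi_gt_three]
  have h2 : (1 / π) * (1 + z^2)⁻¹ ≤ (1 + z^2)⁻¹ := by
    apply mul_le_of_le_one_left _ hp; positivity
  refine (mul_le_mul h1 h2 (by positivity) (by positivity)).trans (le_of_eq ?_)
  rw [Real.mul_rpow hR.le hz'.le]
  ring

lemma dom_int (lam a R : ℝ) (ha : 0 < a) (ha1 : a < 1) :
    Integrable (fun z : ℝ => Real.exp (a / lam) * ((1 + z^2)⁻¹ + R ^ (-a) * (|z| ^ (-a) * (1 + z^2)⁻¹))) :=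
  (integrable_inv_one_add_sq.add ((cauchy_int a ha ha1).const_mul _)).const_mul _

lemma ae_ne (c : ℝ) : ∀ᵐ z : ℝ, z ≠ c := by
  rw [ae_iff]; simp

lemma H8_nonneg (lam a R : ℝ) : 0 ≤ H8 lam a R := by
  apply integral_nonneg; intro z; simp only [Pi.zero_apply]; positivity

lemma H8_bound (lam a : ℝ) (h : 0 < lam) (ha : 0 < a) (ha1 : a < 1) :
    ∃ C ≥ 0, ∀ R > 0, H8 lam a R ≤ C * (1 + R ^ (-a)) := by
  set K := ∫ z : ℝ, |z| ^ (-a) * (1 + z^2)⁻¹ with hK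
  have hK0 : 0 ≤ K := integral_nonneg fun z => by simp only [Pi.zero_apply]; positivity
  refine ⟨Real.exp (a / lam) * (π + K), by positivity, fun R hR => ?_⟩
  have : H8 lam a R ≤ ∫ z : ℝ, Real.exp (a / lam) * ((1 + z^2)⁻¹ + R ^ (-a) * (|z| ^ (-a) * (1 + z^2)⁻¹)) := by
    apply integral_mono_of_nonneg
    · exact ae_of_all _ fun z => by simp only [Pi.zero_apply]; positivity
    · exact dom_int lam a R ha ha1
    · filter_upwards [ae_ne 0] with z hz
      exact integrand_bound lam a R z h ha ha1 hR hz
  refine this.trans ?_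
  rw [integral_const_mul, integral_add integrable_inv_one_add_sq ((cauchy_int a ha ha1).const_mul _),
    integral_univ_inv_one_add_sq, integral_const_mul, ← hK, mul_assoc]
  gcongr
  have : 0 < R ^ (-a) := by positivity
  nlinarith [Real.pi_pos, mul_pos Real.pi_pos this]

lemma g8_tendsto (lam : ℝ) (h : 0 < lam) : Tendsto (g8 lam) atTop (𝓝 0) := by
  have : Tendsto (fun r : ℝ => 1 / lam * (1 / r)) atTop (𝓝 0) := by
    simpa using (tendsto_inv_atTop_zero (𝕜 := ℝ)).const_mul (1 / lam)
  refine tendsto_of_tendsto_of_tendsto_of_le_of_le' tendsto_const_nhds this ?_ ?_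
  · exact Eventually.of_forall fun r => g8_nonneg lam r
  · filter_upwards [eventually_gt_atTop 0] with r hr using g8_le1 lam r h hr

lemma H8_tendsto (lam a : ℝ) (h : 0 < lam) (ha : 0 < a) (ha1 : a < 1) :
    Tendsto (H8 lam a) atTop (𝓝 1) := by
  have e : ∫ z : ℝ, Real.exp (a * π * 0) * ((1 / π) * (1 + z^2)⁻¹) = 1 := by
    rw [integral_const_mul, integral_const_mul, integral_univ_inv_one_add_sq]
    simp [Real.pi_ne_zero]
  rw [← e]
  have hg := g8_meas lam
  apply tendsto_integral_filter_of_dominated_convergence _ _ _ (dom_int lam a 1 ha ha1)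
  · filter_upwards [ae_ne 0] with z hz
    have : Tendsto (fun R : ℝ => R * |z|) atTop atTop :=
      tendsto_id.atTop_mul_const (abs_pos.2 hz)
    have := ((g8_tendsto lam h).comp this).const_mul (a * π)
    exact ((Real.continuous_exp.tendsto _).comp this).mul_const _
  · exact Eventually.of_forall fun R => by
      apply Measurable.aestronglyMeasurable; fun_prop
  · filter_upwards [eventually_ge_atTop 1] with R hR
    filter_upwards [ae_ne 0] with z hz
    rw [Real.norm_of_nonneg (by positivity)]
    refine (integrand_bound lam a R z h ha ha1 (by linarith) hz).trans ?_
    have : R ^ (-a) ≤ 1 ^ (-a) := by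
      exact Real.rpow_le_rpow_of_nonpos one_pos hR (by linarith)
    gcongr

lemma shift_int (a t : ℝ) (ha1 : a < 1) (ht : t ∈ Icc (0:ℝ) 1) :
    IntegrableOn (fun s : ℝ => |t - s| ^ (-a)) (Icc 0 1) ∧
    ∫ s in Icc (0:ℝ) 1, |t - s| ^ (-a) ≤ ∫ z in Icc (-1:ℝ) 1, |z| ^ (-a) := by
  set F : ℝ → ℝ := (Icc (-1:ℝ) 1).indicator (fun z => |z| ^ (-a)) with hF
  have hFi : Integrable F := (integrable_indicator_iff measurableSet_Icc).2 (abs_int a ha1)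
  have hFs : Integrable (fun s => F (t - s)) := hFi.comp_sub_left t
  have heq : ∀ s ∈ Icc (0:ℝ) 1, F (t - s) = |t - s| ^ (-a) := fun s hs => by
    rw [hF, indicator_of_mem]
    exact ⟨by linarith [hs.2, ht.1], by linarith [hs.1, ht.2]⟩
  refine ⟨hFs.integrableOn.congr_fun heq measurableSet_Icc, ?_⟩
  rw [← setIntegral_congr_fun measurableSet_Icc heq, ← integral_indicator (measurableSet_Icc (a := (-1:ℝ))),
    ← hF, ← integral_sub_left_eq_self F volume t]
  apply setIntegral_le_integral hFs
  exact ae_of_all _ fun s => by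
    simp only [Pi.zero_apply, hF]
    exact indicator_nonneg (fun _ _ => by positivity) _

theorem stmt8 (lam γ : ℝ) (hlam : 0 < lam) (hγ0 : 0 < γ) (hγ2 : γ ^ 2 < 1) :
    Tendsto (fun T : ℝ =>
      ∫ t in Icc (0:ℝ) 1, ∫ s in Icc (0:ℝ) 1,
        ∫ y : ℝ,
          Real.exp (γ ^ 2 * π * ∫ u in Ioi (0:ℝ),
              Real.exp (-lam * u) * ((1 / π) * (u / ((T * |y|) ^ 2 + u ^ 2)))) *
            ((1 / π) * (|t - s| / (y ^ 2 + |t - s| ^ 2))))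
      atTop (𝓝 1) := by
  have ha : 0 < γ ^ 2 := by positivity
  generalize γ ^ 2 = a at *
  change Tendsto (fun T : ℝ => ∫ t in Icc (0:ℝ) 1, ∫ s in Icc (0:ℝ) 1, P8 lam a T |t - s|)
    atTop (𝓝 1)
  obtain ⟨C, hC, hH⟩ := H8_bound lam a hlam ha hγ2
  have hb : ∀ T ≥ (1:ℝ), ∀ τ > 0, ‖P8 lam a T τ‖ ≤ C * (1 + τ ^ (-a)) := by
    intro T hT τ hτ
    rw [P8_eq lam a T τ hτ, Real.norm_of_nonneg (H8_nonneg _ _ _)]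
    refine (hH _ (by positivity)).trans ?_
    have : (T * τ) ^ (-a) ≤ τ ^ (-a) :=
      Real.rpow_le_rpow_of_nonpos hτ (by nlinarith) (by linarith)
    gcongr
  have hlim : ∀ τ > 0, Tendsto (fun T => P8 lam a T τ) atTop (𝓝 1) := by
    intro τ hτ
    simp only [fun T => P8_eq lam a T τ hτ]
    exact (H8_tendsto lam a hlam ha hγ2).comp (tendsto_id.atTop_mul_const hτ)
  have hconst : ∫ s in Icc (0:ℝ) 1, (1:ℝ) = 1 := by simp
  have hbi : ∀ t ∈ Icc (0:ℝ) 1, IntegrableOn (fun s => C * (1 + |t - s| ^ (-a))) (Icc 0 1) :=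
    fun t ht => ((integrableOn_const (by simp)).add (shift_int a t hγ2 ht).1).const_mul _
  have hpos : ∀ t : ℝ, ∀ᵐ s ∂(volume.restrict (Icc (0:ℝ) 1)), 0 < |t - s| := fun t => by
    filter_upwards [ae_restrict_of_ae (ae_ne t)] with s hs
    exact abs_pos.2 (sub_ne_zero.2 (Ne.symm hs))
  have hin : ∀ t ∈ Icc (0:ℝ) 1,
      Tendsto (fun T => ∫ s in Icc (0:ℝ) 1, P8 lam a T |t - s|) atTop (𝓝 1) := by
    intro t ht
    refine Eq.subst (motive := fun x : ℝ => Tendsto (fun T => ∫ s in Icc (0:ℝ) 1, P8 lam a T |t - s|) atTop (𝓝 x)) hconst ?_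
    apply tendsto_integral_filter_of_dominated_convergence _ _ _ (hbi t ht)
    · filter_upwards [hpos t] with s hs using hlim _ hs
    · exact Eventually.of_forall fun T => by
        have := P8_meas lam a T
        apply Measurable.aestronglyMeasurable; fun_prop
    · filter_upwards [eventually_ge_atTop 1] with T hT
      filter_upwards [hpos t] with s hs using hb T hT _ hs
  set M := ∫ z in Icc (-1:ℝ) 1, |z| ^ (-a)
  refine Eq.subst (motive := fun x : ℝ => Tendsto (fun T => ∫ t in Icc (0:ℝ) 1, ∫ s in Icc (0:ℝ) 1, P8 lam a T |t - s|) atTop (𝓝 x)) hconst ?_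
  apply tendsto_integral_filter_of_dominated_convergence (fun _ => C * (1 + M)) _ _
    (integrableOn_const (by simp))
  · filter_upwards [ae_restrict_mem measurableSet_Icc] with t ht using hin t ht
  · exact Eventually.of_forall fun T => by
      have := P8_meas lam a T
      have h2 : StronglyMeasurable (fun p : ℝ × ℝ => P8 lam a T |p.1 - p.2|) := by
        apply Measurable.stronglyMeasurable; fun_prop
      exact (h2.integral_prod_right (ν := volume.restrict (Icc (0:ℝ) 1))).aestronglyMeasurable
  · filter_upwards [eventually_ge_atTop 1] with T hT
    filter_upwards [ae_restrict_mem measurableSet_Icc] with t ht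
    refine (norm_integral_le_of_norm_le (hbi t ht) ?_).trans ?_
    · filter_upwards [hpos t] with s hs using hb T hT _ hs
    · rw [integral_const_mul, integral_add (integrable_const _) (shift_int a t hγ2 ht).1, hconst]
      gcongr
      exact (shift_int a t hγ2 ht).2
end

section
/- For every α ∈ (1,2], λ > 0 and r > 0, |(1/π) ∫₀^∞ cos(rθ)/(λ + θ^α/2) dθ| ≤ ((1/λ²) + 4)/(2π·r). -/
open Real MeasureTheory Set Filter Topology

theorem stmt10 (α lam r : ℝ) (hα : α ∈ Ioc (1:ℝ) 2) (hlam : 0 < lam) (hr : 0 < r) :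
    |(1 / π) * ∫ θ in Ioi (0:ℝ), Real.cos (r * θ) / (lam + θ ^ α / 2)|
      ≤ ((1 / lam ^ 2) + 4) / (2 * π * r) := by
  obtain ⟨h1, h2⟩ := hα
  have key : |∫ θ in Ioi (0:ℝ), Real.cos (r * θ) / (lam + θ ^ α / 2)| ≤ 1 / lam / r := by
    by_cases hint : IntegrableOn (fun θ : ℝ => Real.cos (r * θ) / (lam + θ ^ α / 2)) (Ioi 0)
    swap
    · rw [integral_undef hint, abs_zero]; positivity
    have hpos : ∀ x : ℝ, 0 ≤ x → 0 < lam + x ^ α / 2 := fun x hx => by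
      have := Real.rpow_nonneg hx α
      positivity
    have hD : ∀ x : ℝ, HasDerivAt (fun x : ℝ => lam + x ^ α / 2) (α * x ^ (α - 1) / 2) x :=
      fun x => ((Real.hasDerivAt_rpow_const (Or.inr h1.le)).div_const 2).const_add lam
    have hI : ∀ x : ℝ, 0 ≤ x → HasDerivAt (fun x : ℝ => (lam + x ^ α / 2)⁻¹)
        (-(α * x ^ (α - 1) / 2) / (lam + x ^ α / 2) ^ 2) x :=
      fun x hx => (hD x).fun_inv (hpos x hx).ne'
    have htop : Tendsto (fun x : ℝ => (lam + x ^ α / 2)⁻¹) atTop (𝓝 0) := by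
      apply Tendsto.inv_tendsto_atTop
      apply tendsto_atTop_add_const_left
      exact (tendsto_rpow_atTop (by linarith)).atTop_div_const (by norm_num)
    have hnp : ∀ x ∈ Ioi (0:ℝ), -(α * x ^ (α - 1) / 2) / (lam + x ^ α / 2) ^ 2 ≤ 0 := by
      intro x hx
      have := Real.rpow_nonneg (le_of_lt hx) (α - 1)
      have h3 : 0 ≤ α * x ^ (α - 1) / 2 := by positivity
      exact div_nonpos_of_nonpos_of_nonneg (by linarith) (by positivity)
    have hc0 := (hI 0 le_rfl).continuousAt.continuousWithinAt (s := Ici 0)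
    have fint := integrableOn_Ioi_deriv_of_nonpos hc0 (fun x hx => hI x (le_of_lt hx)) hnp htop
    have fval := integral_Ioi_of_hasDerivAt_of_tendsto hc0 (fun x hx => hI x (le_of_lt hx)) fint htop
    rw [Real.zero_rpow (by linarith)] at fval
    have hS : ∀ x : ℝ, HasDerivAt (fun x : ℝ => Real.sin (r * x) / r) (Real.cos (r * x)) x := by
      intro x
      have h6 : HasDerivAt (fun y : ℝ => r * y) r x := by
        simpa using (hasDerivAt_id' x).const_mul r
      have h7 := h6.sin.div_const r
      rwa [mul_div_cancel_right₀ _ hr.ne'] at h7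
    have gint : IntegrableOn (fun x : ℝ => Real.sin (r * x) / r *
        (-(α * x ^ (α - 1) / 2) / (lam + x ^ α / 2) ^ 2)) (Ioi 0) := by
      refine Integrable.bdd_mul (c := 1 / r) fint (by fun_prop) (ae_of_all _ fun x => ?_)
      rw [norm_div, Real.norm_eq_abs, Real.norm_eq_abs, abs_of_pos hr]
      gcongr
      exact Real.abs_sin_le_one _
    have hF : ∀ x : ℝ, 0 ≤ x → HasDerivAt (fun x : ℝ => Real.sin (r * x) / r * (lam + x ^ α / 2)⁻¹)
        (Real.cos (r * x) / (lam + x ^ α / 2) + Real.sin (r * x) / r *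
        (-(α * x ^ (α - 1) / 2) / (lam + x ^ α / 2) ^ 2)) x := by
      intro x hx
      have := (hS x).fun_mul (hI x hx)
      simpa only [div_eq_mul_inv] using this
    have hFtop : Tendsto (fun x : ℝ => Real.sin (r * x) / r * (lam + x ^ α / 2)⁻¹) atTop (𝓝 0) := by
      refine squeeze_zero_norm' (a := fun x => 1 / r * (lam + x ^ α / 2)⁻¹) ?_ (by simpa using htop.const_mul (1 / r))
      filter_upwards [eventually_ge_atTop 0] with x hx
      have := hpos x hx
      rw [norm_mul, norm_div, Real.norm_eq_abs, Real.norm_eq_abs, Real.norm_eq_abs, abs_of_pos hr,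
        abs_of_pos (inv_pos.2 this)]
      gcongr
      exact Real.abs_sin_le_one _
    have Fval := integral_Ioi_of_hasDerivAt_of_tendsto
      ((hF 0 le_rfl).continuousAt.continuousWithinAt (s := Ici 0))
      (fun x hx => hF x (le_of_lt hx)) (hint.add gint) hFtop
    rw [integral_add hint gint] at Fval
    simp only [mul_zero, Real.sin_zero, zero_div, zero_mul, sub_zero] at Fval
    rw [eq_neg_of_add_eq_zero_left Fval, abs_neg, ← Real.norm_eq_abs]
    have hb : ∀ x ∈ Ioi (0:ℝ), ‖Real.sin (r * x) / r *
        (-(α * x ^ (α - 1) / 2) / (lam + x ^ α / 2) ^ 2)‖ ≤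
        (-1 / r) * (-(α * x ^ (α - 1) / 2) / (lam + x ^ α / 2) ^ 2) := by
      intro x hx
      have h4 := hnp x hx
      rw [norm_mul, norm_div, Real.norm_eq_abs, Real.norm_eq_abs, Real.norm_eq_abs, abs_of_pos hr,
        abs_of_nonpos h4, neg_div r 1, neg_mul_comm]
      gcongr
      · linarith
      · exact Real.abs_sin_le_one _
    have := norm_integral_le_of_norm_le (fint.const_mul (-1 / r))
      ((ae_restrict_iff' measurableSet_Ioi).2 (ae_of_all _ hb))
    refine this.trans (le_of_eq ?_)
    rw [integral_const_mul, fval]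
    field_simp
    ring
  rw [abs_mul, abs_of_pos (by positivity : 0 < 1 / π)]
  have h5 : 1 / lam ≤ (1 / lam ^ 2 + 4) / 2 := by
    have : 1 / lam ^ 2 = (1 / lam) ^ 2 := by rw [div_pow, one_pow]
    rw [this]
    nlinarith [sq_nonneg (1 / lam - 1)]
  calc _ ≤ 1 / π * (1 / lam / r) := by gcongr
    _ ≤ 1 / π * ((1 / lam ^ 2 + 4) / 2 / r) := by gcongr
    _ = _ := by field_simp
end

section
/- Fix λ > 0. For every x, y ∈ ℝ with x ≠ y, lim_{α→1⁺} ∫₀^∞ e^{−λt} · p^α(t, x−y) dt = ∫₀^∞ e^{−λt} · p^1(t, x−y) dt; that is, the λ-order Green's functions g_λ^α(x,y) of the symmetric α-stable processes converge pointwise off the diagonal to the λ-order Green's function of the Cauchy process as α decreases to 1. -/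
open Real MeasureTheory Set Filter Topology

lemma aux_int (s : ℝ) (hs : 0 < s) : Integrable (fun θ : ℝ => Real.exp (-s * |θ|)) := by
  apply Integrable.of_integral_ne_zero
  rw [integral_comp_abs (f := fun x => Real.exp (-s * x)), integral_exp_mul_Ioi (by linarith) 0]
  simp [hs.ne']

lemma aux_le (s : ℝ) (hs : 0 < s) (α : ℝ) (hα : 1 < α) (θ : ℝ) :
    Real.exp (-s * |θ| ^ α) ≤ Real.exp s * Real.exp (-s * |θ|) := by
  rw [← Real.exp_add]
  apply Real.exp_le_exp.2
  have h : |θ| - 1 ≤ |θ| ^ α := by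
    rcases le_total 1 |θ| with h | h
    · have := Real.rpow_le_rpow_of_exponent_le h hα.le
      rw [Real.rpow_one] at this
      linarith
    · have := Real.rpow_nonneg (abs_nonneg θ) α
      linarith
  nlinarith

lemma aux_cont (s : ℝ) (α : ℝ) (hα : 1 < α) :
    Continuous (fun θ : ℝ => Real.exp (-s * |θ| ^ α)) := by
  have : Continuous (fun θ : ℝ => |θ| ^ α) :=
    continuous_abs.rpow_const (fun _ => Or.inr (by linarith))
  fun_prop

lemma aux_int2 (s : ℝ) (hs : 0 < s) (α : ℝ) (hα : 1 < α) :
    Integrable (fun θ : ℝ => Real.exp (-s * |θ| ^ α)) := by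
  refine ((aux_int s hs).const_mul (Real.exp s)).mono'
    (aux_cont s α hα).aestronglyMeasurable (Eventually.of_forall fun θ => ?_)
  rw [Real.norm_eq_abs, abs_of_pos (Real.exp_pos _)]
  exact aux_le s hs α hα θ

lemma aux_lim (z t : ℝ) (ht : 0 < t) :
    Tendsto (fun α : ℝ => ∫ θ : ℝ, Real.cos (θ * z) * Real.exp (-(t / 2) * |θ| ^ α)) (𝓝[>] 1)
      (𝓝 (∫ θ : ℝ, Real.cos (θ * z) * Real.exp (-(t / 2) * |θ|))) := by
  refine tendsto_integral_filter_of_dominated_convergence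
    (fun θ => Real.exp (t/2) * Real.exp (-(t/2) * |θ|)) ?_ ?_
    ((aux_int (t/2) (by linarith)).const_mul _) ?_
  · filter_upwards [self_mem_nhdsWithin] with α hα
    have := aux_cont (t/2) α hα
    exact Continuous.aestronglyMeasurable (by fun_prop)
  · filter_upwards [self_mem_nhdsWithin] with α hα
    refine Eventually.of_forall fun θ => ?_
    rw [norm_mul, Real.norm_eq_abs, Real.norm_eq_abs, abs_of_pos (Real.exp_pos _)]
    refine le_trans ?_ (aux_le (t/2) (by linarith) α hα θ)
    exact mul_le_of_le_one_left (Real.exp_pos _).le (Real.abs_cos_le_one _)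
  · refine Eventually.of_forall fun θ => ?_
    have h : Tendsto (fun α : ℝ => |θ| ^ α) (𝓝[>] 1) (𝓝 |θ|) := by
      have := (Real.continuousAt_const_rpow' (a := |θ|) (b := 1) one_ne_zero).tendsto
      rw [Real.rpow_one] at this
      exact this.mono_left nhdsWithin_le_nhds
    exact ((Real.continuous_exp.tendsto _).comp (h.const_mul _)).const_mul _

lemma aux_bound (z s α : ℝ) (hz : z ≠ 0) (hs : 0 < s) (hα : 1 < α) :
    |∫ θ : ℝ, Real.cos (θ * z) * Real.exp (-s * |θ| ^ α)| ≤ 2 / |z| := by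
  have e1 : ∫ θ : ℝ, Real.cos (θ * z) * Real.exp (-s * |θ| ^ α) =
      2 * ∫ θ in Ioi (0:ℝ), Real.cos (θ * z) * Real.exp (-s * θ ^ α) := by
    rw [← integral_comp_abs (f := fun θ => Real.cos (θ * z) * Real.exp (-s * θ ^ α))]
    congr 1
    ext θ
    congr 1
    rcases abs_cases θ with h | h <;> rw [h.1]
    rw [neg_mul, Real.cos_neg]
  set u : ℝ → ℝ := fun θ => Real.exp (-s * θ ^ α) with hu
  set u' : ℝ → ℝ := fun θ => Real.exp (-s * θ ^ α) * (-s * (α * θ ^ (α - 1))) with hu'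
  set v : ℝ → ℝ := fun θ => Real.sin (θ * z) / z with hv
  set v' : ℝ → ℝ := fun θ => Real.cos (θ * z) with hv'
  have du : ∀ x ∈ Ioi (0:ℝ), HasDerivAt u (u' x) x := fun x hx =>
    ((Real.hasDerivAt_rpow_const (Or.inl (ne_of_gt hx))).const_mul (-s)).exp
  have dv : ∀ x ∈ Ioi (0:ℝ), HasDerivAt v (v' x) x := fun x hx => by
    have := (((hasDerivAt_id x).mul_const z).sin).div_const z
    refine this.congr_deriv ?_
    simp only [hv', id, one_mul]; field_simp
  have cu : Continuous u := by
    have : Continuous (fun θ : ℝ => θ ^ α) :=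
      continuous_id.rpow_const (fun _ => Or.inr (by linarith))
    fun_prop
  have cv : Continuous v := by fun_prop
  have u0 : u 0 = 1 := by simp [hu, Real.zero_rpow (by linarith : α ≠ 0)]
  have nu : ∀ x ∈ Ioi (0:ℝ), u' x ≤ 0 := fun x hx => by
    have h1 : 0 ≤ x ^ (α - 1) := Real.rpow_nonneg (le_of_lt hx) _
    have : 0 ≤ Real.exp (-s * x ^ α) * (s * (α * x ^ (α - 1))) := by positivity
    simp only [hu']
    linarith
  have tu : Tendsto u atTop (𝓝 0) :=
    Real.tendsto_exp_atBot.comp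
      ((tendsto_rpow_atTop (by linarith : 0 < α)).const_mul_atTop_of_neg (by linarith))
  have iu' : IntegrableOn u' (Ioi 0) :=
    integrableOn_Ioi_deriv_of_nonpos cu.continuousWithinAt du nu tu
  have Iu' : ∫ x in Ioi (0:ℝ), u' x = -1 := by
    rw [integral_Ioi_of_hasDerivAt_of_nonpos cu.continuousWithinAt du nu tu, u0]; norm_num
  have bv : ∀ x, ‖v x‖ ≤ 1 / |z| := fun x => by
    simp only [hv, norm_div, Real.norm_eq_abs]
    gcongr
    exact Real.abs_sin_le_one _
  have iu : IntegrableOn u (Ioi 0) := by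
    refine ((aux_int2 s hs α hα).integrableOn (s := Ioi 0)).congr_fun (fun x hx => ?_)
      measurableSet_Ioi
    simp only [hu]
    rw [abs_of_pos hx]
  have iuv' : IntegrableOn (u * v') (Ioi 0) := by
    refine iu.mul_bdd (c := 1) (Continuous.aestronglyMeasurable (by fun_prop))
      (Eventually.of_forall fun x => ?_)
    exact Real.abs_cos_le_one _
  have iu'v : IntegrableOn (u' * v) (Ioi 0) :=
    iu'.mul_bdd (c := 1 / |z|) cv.aestronglyMeasurable (Eventually.of_forall bv)
  have t0 : Tendsto (u * v) (𝓝[>] 0) (𝓝 0) := by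
    have := ((cu.mul cv).tendsto 0).mono_left (nhdsWithin_le_nhds (s := Ioi 0))
    simpa [hv] using this
  have ti : Tendsto (u * v) atTop (𝓝 0) :=
    tu.zero_mul_isBoundedUnder_le (isBoundedUnder_of ⟨1 / |z|, bv⟩)
  have key := integral_Ioi_mul_deriv_eq_deriv_mul du dv iuv' iu'v t0 ti
  have key2 : ‖∫ x in Ioi (0:ℝ), u' x * v x‖ ≤ 1 / |z| := by
    have h : ∫ x in Ioi (0:ℝ), (-u' x) * (1 / |z|) = 1 / |z| := by
      rw [integral_mul_const, integral_neg, Iu']; ring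
    rw [← h]
    refine norm_integral_le_of_norm_le (iu'.neg.mul_const _) ?_
    refine (ae_restrict_iff' measurableSet_Ioi).2 (Eventually.of_forall fun x hx => ?_)
    rw [norm_mul, Real.norm_of_nonpos (nu x hx)]
    exact mul_le_mul_of_nonneg_left (bv x) (by linarith [nu x hx])
  rw [e1]
  have e2 : ∫ θ in Ioi (0:ℝ), Real.cos (θ * z) * Real.exp (-s * θ ^ α) =
      - ∫ x in Ioi (0:ℝ), u' x * v x := by
    rw [sub_self, zero_sub] at key
    rw [← key]
    congr 1
    ext θ
    exact mul_comm _ _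
  rw [e2, abs_mul, abs_neg, abs_two]
  rw [Real.norm_eq_abs] at key2
  calc _ ≤ 2 * (1 / |z|) := by linarith
    _ = _ := by ring

theorem stmt13 (lam : ℝ) (hlam : 0 < lam) (x y : ℝ) (hxy : x ≠ y) :
    Tendsto (fun α : ℝ =>
        ∫ t in Ioi (0:ℝ), Real.exp (-lam * t) *
          ((1 / (2 * π)) * ∫ θ : ℝ, Real.cos (θ * (x - y)) * Real.exp (-(t / 2) * |θ| ^ α)))
      (𝓝[>] 1)
      (𝓝 (∫ t in Ioi (0:ℝ), Real.exp (-lam * t) *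
          ((1 / (2 * π)) * ∫ θ : ℝ, Real.cos (θ * (x - y)) * Real.exp (-(t / 2) * |θ|)))) := by
  refine tendsto_integral_filter_of_dominated_convergence
    (fun t => Real.exp (-lam * t) * ((1 / (2 * π)) * (2 / |x - y|))) ?_ ?_
    ((exp_neg_integrableOn_Ioi 0 hlam).mul_const _) ?_
  · refine Eventually.of_forall fun α => ?_
    have h : StronglyMeasurable (fun t : ℝ =>
        ∫ θ : ℝ, Real.cos (θ * (x - y)) * Real.exp (-(t / 2) * |θ| ^ α)) := by
      apply StronglyMeasurable.integral_prod_right'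
        (f := fun p : ℝ × ℝ => Real.cos (p.2 * (x - y)) * Real.exp (-(p.1 / 2) * |p.2| ^ α))
      apply Measurable.stronglyMeasurable
      fun_prop
    have h2 : Measurable (fun t : ℝ => Real.exp (-lam * t)) := by fun_prop
    exact (h2.stronglyMeasurable.mul (h.const_mul _)).aestronglyMeasurable
  · filter_upwards [self_mem_nhdsWithin] with α hα
    refine (ae_restrict_iff' measurableSet_Ioi).2 (Eventually.of_forall fun t ht => ?_)
    have ht' : 0 < t := ht
    have := aux_bound (x - y) (t / 2) α (sub_ne_zero.2 hxy) (by linarith) hα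
    rw [norm_mul, norm_mul, Real.norm_of_nonneg (Real.exp_pos _).le,
      Real.norm_of_nonneg (by positivity : 0 ≤ 1 / (2 * π)), Real.norm_eq_abs]
    gcongr
  · refine (ae_restrict_iff' measurableSet_Ioi).2 (Eventually.of_forall fun t ht => ?_)
    exact ((aux_lim (x - y) t ht).const_mul _).const_mul _
end
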